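/- Let w ∈ S_N. If w has no N-occurrence of any of the patterns 45231, 45132, 43512, 34512, 35412, 45123, and 45213, then every N-occurrence of the pattern 3412 in w is equal to 𝔭_k(w) for some k ∈ newrep(w). -/

import Mathlib

/-!
Common framework.  Permutations of `{1, …, m}` are modelled as `Equiv.Perm (Fin m)`
with 0-based positions and values.  The simple reflection `sr m i` (for
`0 ≤ i ≤ m - 2`, corresponding to the paper's `s_{i+1}`) swaps the values `i` and
`i + 1`.  Cut statistics `Mstat w k` / `mstat w k` (the paper's `M_{k+1}`/`m_{k+1}`)
are respectively the maximum of the first `k + 1` entries and the minimum of the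
remaining entries of the one-line notation of `w`.
-/

/-- The simple reflection swapping `i` and `i + 1` (0-based) in the symmetric group
on `Fin m`; the identity if out of range. -/
def sr (m i : ℕ) : Equiv.Perm (Fin m) :=
  if h : i + 1 < m then Equiv.swap ⟨i, Nat.lt_of_succ_lt h⟩ ⟨i + 1, h⟩ else 1

/-- `l` is a word in the simple reflections whose product is `w`. -/
def IsWord (m : ℕ) (l : List ℕ) (w : Equiv.Perm (Fin m)) : Prop :=
  (∀ i ∈ l, i + 1 < m) ∧ (l.map (sr m)).prod = w

/-- The Coxeter length `ℓ(w)`: the minimal length of a word expressing `w`. -/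
noncomputable def len {m : ℕ} (w : Equiv.Perm (Fin m)) : ℕ :=
  sInf {c | ∃ l : List ℕ, IsWord m l w ∧ l.length = c}

/-- `l` is a reduced decomposition of `w`. -/
def IsReducedWord {m : ℕ} (w : Equiv.Perm (Fin m)) (l : List ℕ) : Prop :=
  IsWord m l w ∧ l.length = len w

/-- The support of `w`: the letters appearing in some reduced decomposition. -/
noncomputable def supp {m : ℕ} (w : Equiv.Perm (Fin m)) : Set ℕ :=
  {i | ∃ l : List ℕ, IsReducedWord w l ∧ i ∈ l}

/-- `rep w = ℓ(w) - |supp w|`, the number of repeated letters. -/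
noncomputable def rep {m : ℕ} (w : Equiv.Perm (Fin m)) : ℕ :=
  len w - (supp w).ncard

/-- The value of `w` at the (0-based) position `i`, as a natural number. -/
def valAt {m : ℕ} (w : Equiv.Perm (Fin m)) (i : ℕ) : ℕ :=
  if h : i < m then (w ⟨i, h⟩ : ℕ) else 0

/-- The (0-based) position at which the value `v` occurs in `w`. -/
def posOf {m : ℕ} (w : Equiv.Perm (Fin m)) (v : ℕ) : ℕ :=
  if h : v < m then (w⁻¹ ⟨v, h⟩ : ℕ) else 0

/-- `Mstat w k`: the maximum of the first `k + 1` entries of `w`. -/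
noncomputable def Mstat {m : ℕ} (w : Equiv.Perm (Fin m)) (k : ℕ) : ℕ :=
  sSup {v | ∃ i : Fin m, (i : ℕ) ≤ k ∧ (w i : ℕ) = v}

/-- `mstat w k`: the minimum of the entries of `w` in positions `> k`. -/
noncomputable def mstat {m : ℕ} (w : Equiv.Perm (Fin m)) (k : ℕ) : ℕ :=
  sInf {v | ∃ i : Fin m, k < (i : ℕ) ∧ (w i : ℕ) = v}

/-- `wbar` is obtained from `w` by deleting the largest letter from the one-line
notation of `w` and sliding all subsequent letters one space to the left. -/
def IsDeletion {n : ℕ} (w : Equiv.Perm (Fin (n + 1))) (wbar : Equiv.Perm (Fin n)) : Prop :=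
  ∀ i : Fin n, (wbar i : ℕ) =
    if (i : ℕ) < posOf w n then valAt w (i : ℕ) else valAt w ((i : ℕ) + 1)

/-- `newrep w wbar`: the letters `k` with `s_k ∈ supp(wbar)` and `w⁻¹(top) ≤ k`. -/
noncomputable def newrep {n : ℕ} (w : Equiv.Perm (Fin (n + 1))) (wbar : Equiv.Perm (Fin n)) :
    Set ℕ :=
  {k | k ∈ supp wbar ∧ posOf w n ≤ k}

/-- An occurrence of the pattern `p` in `w`, recorded by its set `S` of values:
there are positions `f 0 < f 1 < ⋯` whose values are in the same relative order
as `p`, and `S` is the corresponding set of values. -/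
def IsOccSet {m c : ℕ} (p : Fin c → ℕ) (w : Equiv.Perm (Fin m)) (S : Finset ℕ) : Prop :=
  ∃ f : Fin c → Fin m, StrictMono f ∧ (∀ a b : Fin c, p a < p b ↔ w (f a) < w (f b)) ∧
    S = Finset.image (fun a => (w (f a) : ℕ)) Finset.univ

/-- An `N`-occurrence (here `N = n`, the largest 0-based value): an occurrence
whose largest letter is the largest value of `w`. -/
def IsTopOccSet {n c : ℕ} (p : Fin c → ℕ) (w : Equiv.Perm (Fin (n + 1))) (S : Finset ℕ) : Prop :=
  IsOccSet p w S ∧ n ∈ S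

/-- The number of occurrences of the pattern `p` in `w`. -/
noncomputable def occCount {m c : ℕ} (p : Fin c → ℕ) (w : Equiv.Perm (Fin m)) : ℕ :=
  Set.ncard {S : Finset ℕ | IsOccSet p w S}

/-- The number of `N`-occurrences of the pattern `p` in `w`. -/
noncomputable def topOccCount {n c : ℕ} (p : Fin c → ℕ) (w : Equiv.Perm (Fin (n + 1))) : ℕ :=
  Set.ncard {S : Finset ℕ | IsTopOccSet p w S}

def p321 : Fin 3 → ℕ := ![3, 2, 1]
def p3412 : Fin 4 → ℕ := ![3, 4, 1, 2]
def p4321 : Fin 4 → ℕ := ![4, 3, 2, 1]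
def p34512 : Fin 5 → ℕ := ![3, 4, 5, 1, 2]
def p45123 : Fin 5 → ℕ := ![4, 5, 1, 2, 3]
def p35412 : Fin 5 → ℕ := ![3, 5, 4, 1, 2]
def p43512 : Fin 5 → ℕ := ![4, 3, 5, 1, 2]
def p45132 : Fin 5 → ℕ := ![4, 5, 1, 3, 2]
def p45213 : Fin 5 → ℕ := ![4, 5, 2, 1, 3]
def p53412 : Fin 5 → ℕ := ![5, 3, 4, 1, 2]
def p45312 : Fin 5 → ℕ := ![4, 5, 3, 1, 2]
def p45231 : Fin 5 → ℕ := ![4, 5, 2, 3, 1]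

/-- The pattern `𝔭_k(w)` of Definition 4.4, recorded as its set of values:
(I) if `w⁻¹(top)` is left of `w⁻¹(M_k)`, the 321-occurrence `{top, M_k, m_k}`;
(II) else if `wbar(k) > m_k`, the 321-occurrence `{top, wbar(k), m_k}`;
(III) otherwise the 3412-occurrence `{M_k, top, wbar(k), m_k}`. -/
noncomputable def pocc {n : ℕ} (w : Equiv.Perm (Fin (n + 1))) (wbar : Equiv.Perm (Fin n))
    (k : ℕ) : Finset ℕ :=
  if posOf w n < posOf w (Mstat wbar k) then {n, Mstat wbar k, mstat wbar k}
  else if mstat wbar k < valAt wbar k then {n, valAt wbar k, mstat wbar k}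
  else {Mstat wbar k, n, valAt wbar k, mstat wbar k}

theorem exists_isWord {m : ℕ} (w : Equiv.Perm (Fin m)) : ∃ l, IsWord m l w := by
  cases m with
  | zero => exact ⟨[], by simp, Subsingleton.elim _ _⟩
  | succ m =>
    have hw : w ∈ Submonoid.closure
        (Set.range fun i : Fin m => Equiv.swap i.castSucc i.succ) := by
      rw [Equiv.Perm.mclosure_swap_castSucc_succ]; trivial
    induction hw using Submonoid.closure_induction with
    | mem x hx =>
      obtain ⟨i, rfl⟩ := hx
      exact ⟨[i], by simp, by simp [sr]; rfl⟩
    | one => exact ⟨[], by simp, by simp⟩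
    | mul x y _ _ hx hy =>
      obtain ⟨l, hl, hlx⟩ := hx
      obtain ⟨l', hl', hly⟩ := hy
      refine ⟨l ++ l', fun i hi => ?_, by simp [hlx, hly]⟩
      rcases List.mem_append.1 hi with h | h
      exacts [hl i h, hl' i h]

theorem exists_isReducedWord {m : ℕ} (w : Equiv.Perm (Fin m)) : ∃ l, IsReducedWord w l := by
  obtain ⟨l, hl⟩ := exists_isWord w
  exact Nat.sInf_mem (s := {c | ∃ l : List ℕ, IsWord m l w ∧ l.length = c}) ⟨_, l, hl, rfl⟩

theorem sr_apply_le_iff {m i k : ℕ} (hik : i ≠ k) (x : Fin m) :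
    (sr m i x : ℕ) ≤ k ↔ (x : ℕ) ≤ k := by
  unfold sr
  split_ifs
  · rw [Equiv.swap_apply_def]
    split_ifs with h1 h2 <;> simp_all <;> omega
  · rfl

theorem prod_sr_apply_le_iff {m k : ℕ} (l : List ℕ) (hk : k ∉ l) (x : Fin m) :
    ((l.map (sr m)).prod x : ℕ) ≤ k ↔ (x : ℕ) ≤ k := by
  induction l with
  | nil => simp
  | cons i l ih =>
    simp only [List.mem_cons, not_or] at hk
    rw [List.map_cons, List.prod_cons, Equiv.Perm.mul_apply, sr_apply_le_iff (Ne.symm hk.1),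
      ih hk.2]

/-- A cut crossed by an inversion belongs to the support. -/
theorem mem_supp_of_inversion {m k : ℕ} (w : Equiv.Perm (Fin m)) {i j : Fin m}
    (hi : (i : ℕ) ≤ k) (hj : k < j) (hij : w j < w i) : k ∈ supp w := by
  obtain ⟨l, hl⟩ := exists_isReducedWord w
  refine ⟨l, hl, by_contra fun hk => ?_⟩
  have hle := fun x => prod_sr_apply_le_iff (m := m) l hk x
  rw [hl.1.2] at hle
  have h1 := (hle i).2 hi
  have h2 := mt (hle j).1 (by omega)
  have h3 : (w j : ℕ) < w i := hij
  omega

theorem valAt_coe {m : ℕ} (w : Equiv.Perm (Fin m)) (i : Fin m) : valAt w i = w i := by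
  simp [valAt]

theorem posOf_apply {m : ℕ} (w : Equiv.Perm (Fin m)) (i : Fin m) : posOf w (w i) = i := by
  simp [posOf]

theorem Mstat_eq {m k : ℕ} (w : Equiv.Perm (Fin m)) {i : Fin m} (hi : (i : ℕ) ≤ k)
    (hmax : ∀ j : Fin m, (j : ℕ) ≤ k → (w j : ℕ) ≤ w i) : Mstat w k = w i :=
  IsGreatest.csSup_eq ⟨⟨i, hi, rfl⟩, by rintro _ ⟨j, hj, rfl⟩; exact hmax j hj⟩

theorem mstat_eq {m k : ℕ} (w : Equiv.Perm (Fin m)) {i : Fin m} (hi : k < (i : ℕ))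
    (hmin : ∀ j : Fin m, k < (j : ℕ) → (w i : ℕ) ≤ w j) : mstat w k = w i :=
  IsLeast.csInf_eq ⟨⟨i, hi, rfl⟩, by rintro _ ⟨j, hj, rfl⟩; exact hmin j hj⟩

theorem IsDeletion.apply_of_lt {n : ℕ} {w : Equiv.Perm (Fin (n + 1))} {wbar : Equiv.Perm (Fin n)}
    (hdel : IsDeletion w wbar) {i : Fin n} {q : Fin (n + 1)} (hq : (q : ℕ) = i)
    (hlt : (i : ℕ) < posOf w n) : (wbar i : ℕ) = w q := by
  rw [hdel i, if_pos hlt, ← hq, valAt_coe]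

theorem IsDeletion.apply_of_le {n : ℕ} {w : Equiv.Perm (Fin (n + 1))} {wbar : Equiv.Perm (Fin n)}
    (hdel : IsDeletion w wbar) {i : Fin n} {q : Fin (n + 1)} (hq : (q : ℕ) = i + 1)
    (hle : posOf w n ≤ i) : (wbar i : ℕ) = w q := by
  rw [hdel i, if_neg (by omega), ← hq, valAt_coe]

/-- Five increasing positions with values in the relative order of `p`, one of them the top
value, contradict the absence of top occurrences of `p`. -/
theorem false_of_top_pattern {n : ℕ} {w : Equiv.Perm (Fin (n + 1))} {p : Fin 5 → ℕ}
    (h : ¬ ∃ S : Finset ℕ, IsTopOccSet p w S) {x₀ x₁ x₂ x₃ x₄ : Fin (n + 1)}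
    (h₀₁ : x₀ < x₁) (h₁₂ : x₁ < x₂) (h₂₃ : x₂ < x₃) (h₃₄ : x₃ < x₄)
    (hord : ∀ a b : Fin 5, p a < p b ↔ w (![x₀, x₁, x₂, x₃, x₄] a) < w (![x₀, x₁, x₂, x₃, x₄] b))
    (j : Fin 5) (hj : (w (![x₀, x₁, x₂, x₃, x₄] j) : ℕ) = n) : False := by
  refine h ⟨_, ⟨![x₀, x₁, x₂, x₃, x₄], ?_, hord, rfl⟩, Finset.mem_image.2 ⟨j, by simp, hj⟩⟩
  rw [Fin.strictMono_iff_lt_succ]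
  intro i
  fin_cases i
  exacts [h₀₁, h₁₂, h₂₃, h₃₄]

/-- if `w` has no `N`-occurrence of any of 45231, 45132, 43512, 34512,
35412, 45123, 45213, then every `N`-occurrence of 3412 in `w` equals `𝔭_k(w)` for
some `k ∈ newrep(w)`. -/
theorem all_top_3412_are_pocc {n : ℕ} (w : Equiv.Perm (Fin (n + 1)))
    (wbar : Equiv.Perm (Fin n)) (hdel : IsDeletion w wbar)
    (h1 : ¬ ∃ S : Finset ℕ, IsTopOccSet p45231 w S)
    (h2 : ¬ ∃ S : Finset ℕ, IsTopOccSet p45132 w S)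
    (h3 : ¬ ∃ S : Finset ℕ, IsTopOccSet p43512 w S)
    (h4 : ¬ ∃ S : Finset ℕ, IsTopOccSet p34512 w S)
    (h5 : ¬ ∃ S : Finset ℕ, IsTopOccSet p35412 w S)
    (h6 : ¬ ∃ S : Finset ℕ, IsTopOccSet p45123 w S)
    (h7 : ¬ ∃ S : Finset ℕ, IsTopOccSet p45213 w S) :
    ∀ S : Finset ℕ, IsTopOccSet p3412 w S → ∃ k ∈ newrep w wbar, pocc w wbar k = S := by
  rintro S ⟨⟨f, hf, hord, rfl⟩, hn⟩
  obtain ⟨a, N, b, c, rfl⟩ : ∃ a N b c, f = ![a, N, b, c] :=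
    ⟨f 0, f 1, f 2, f 3, by ext i; fin_cases i <;> rfl⟩
  have haN : a < N := hf (show (0 : Fin 4) < 1 by decide)
  have hNb : N < b := hf (show (1 : Fin 4) < 2 by decide)
  have hbc : b < c := hf (show (2 : Fin 4) < 3 by decide)
  have wbc : w b < w c := (hord 2 3).1 (by decide)
  have wca : w c < w a := (hord 3 0).1 (by decide)
  have waN : w a < w N := (hord 0 1).1 (by decide)
  have hN : (w N : ℕ) = n := by
    obtain ⟨j, -, hj⟩ := Finset.mem_image.1 hn
    have hlt := (w N).isLt
    fin_cases j <;> simp at hj <;> omega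
  clear hf hord hn
  have hpos : posOf w n = N := by simpa only [hN] using posOf_apply w N
  have hne {x y : Fin (n + 1)} (h : (x : ℕ) ≠ y) : (w x : ℕ) ≠ w y := fun e =>
    h (congrArg Fin.val (w.injective (Fin.ext e)))
  have hmax (x : Fin (n + 1)) (hx : x < b) (hxN : x ≠ N) : w x ≤ w a := by
    by_contra! hlt
    have hxa : x ≠ a := by rintro rfl; exact lt_irrefl _ hlt
    have hxn : (w x : ℕ) < n := by
      have := hne (Fin.val_ne_of_ne hxN)
      omega
    rcases lt_or_gt_of_ne hxa with h | h
    · exact false_of_top_pattern h3 (x₀ := x) (x₁ := a) (x₂ := N) (x₃ := b) (x₄ := c)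
        (by omega) (by omega) (by omega) (by omega)
        (by intro s t; fin_cases s <;> fin_cases t <;> simp [p43512] <;> omega) 2 hN
    rcases lt_or_gt_of_ne hxN with h' | h'
    · exact false_of_top_pattern h4 (x₀ := a) (x₁ := x) (x₂ := N) (x₃ := b) (x₄ := c)
        (by omega) (by omega) (by omega) (by omega)
        (by intro s t; fin_cases s <;> fin_cases t <;> simp [p34512] <;> omega) 2 hN
    · exact false_of_top_pattern h5 (x₀ := a) (x₁ := N) (x₂ := x) (x₃ := b) (x₄ := c)
        (by omega) (by omega) (by omega) (by omega)
        (by intro s t; fin_cases s <;> fin_cases t <;> simp [p35412] <;> omega) 1 hN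
  have hmin (y : Fin (n + 1)) (hy : b < y) : w c ≤ w y := by
    by_contra! hlt
    have hyc : y ≠ c := by rintro rfl; exact lt_irrefl _ hlt
    have hyb := hne (Fin.val_ne_of_ne hy.ne')
    rcases lt_or_gt_of_ne hyc with h | h <;> rcases lt_or_gt_of_ne hyb with h' | h'
    · exact false_of_top_pattern h7 (x₀ := a) (x₁ := N) (x₂ := b) (x₃ := y) (x₄ := c)
        (by omega) (by omega) (by omega) (by omega)
        (by intro s t; fin_cases s <;> fin_cases t <;> simp [p45213] <;> omega) 1 hN
    · exact false_of_top_pattern h6 (x₀ := a) (x₁ := N) (x₂ := b) (x₃ := y) (x₄ := c)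
        (by omega) (by omega) (by omega) (by omega)
        (by intro s t; fin_cases s <;> fin_cases t <;> simp [p45123] <;> omega) 1 hN
    · exact false_of_top_pattern h1 (x₀ := a) (x₁ := N) (x₂ := b) (x₃ := c) (x₄ := y)
        (by omega) (by omega) (by omega) (by omega)
        (by intro s t; fin_cases s <;> fin_cases t <;> simp [p45231] <;> omega) 1 hN
    · exact false_of_top_pattern h2 (x₀ := a) (x₁ := N) (x₂ := b) (x₃ := c) (x₄ := y)
        (by omega) (by omega) (by omega) (by omega)
        (by intro s t; fin_cases s <;> fin_cases t <;> simp [p45132] <;> omega) 1 hN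
  have hcn := c.isLt
  let i : Fin n := ⟨a, by omega⟩
  let k : Fin n := ⟨b - 1, by omega⟩
  let j : Fin n := ⟨c - 1, by omega⟩
  have hi : (wbar i : ℕ) = w a := hdel.apply_of_lt rfl (by simp only [i]; omega)
  have hk : (wbar k : ℕ) = w b :=
    hdel.apply_of_le (by simp only [k]; omega) (by simp only [k]; omega)
  have hj : (wbar j : ℕ) = w c :=
    hdel.apply_of_le (by simp only [j]; omega) (by simp only [j]; omega)
  have hik : (i : ℕ) ≤ k := by simp only [i, k]; omega
  have hkj : (k : ℕ) < j := by simp only [j, k]; omega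
  have hM : Mstat wbar k = w a := by
    rw [← hi]
    refine Mstat_eq wbar hik fun x hx => ?_
    rw [hi]
    have hxb : (x : ℕ) ≤ b - 1 := hx
    rcases lt_or_ge (x : ℕ) (posOf w n) with h | h
    · rw [hdel.apply_of_lt (q := x.castSucc) rfl h]
      exact hmax _ (by rw [Fin.lt_def, Fin.val_castSucc]; omega)
        (Fin.ne_of_val_ne (by rw [Fin.val_castSucc]; omega))
    · rcases hxb.lt_or_eq with hxb | hxb
      · rw [hdel.apply_of_le (q := x.succ) (by simp) h]
        exact hmax _ (by rw [Fin.lt_def, Fin.val_succ]; omega)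
          (Fin.ne_of_val_ne (by rw [Fin.val_succ]; omega))
      · rw [hdel.apply_of_le (q := b) (by omega) h]
        exact (wbc.trans wca).le
  have hm : mstat wbar k = w c := by
    rw [← hj]
    refine mstat_eq wbar hkj fun x hx => ?_
    have hbx : (b : ℕ) - 1 < x := hx
    rw [hj, hdel.apply_of_le (q := x.succ) (by simp) (by omega)]
    exact hmin _ (by rw [Fin.lt_def, Fin.val_succ]; omega)
  refine ⟨k, ⟨mem_supp_of_inversion wbar hik hkj ?_, ?_⟩, ?_⟩
  · rw [Fin.lt_def, hi, hj]; exact wca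
  · simp only [k]; omega
  · unfold pocc
    rw [hM, hm, valAt_coe, hk, posOf_apply, hpos, if_neg (by omega), if_neg (by omega)]
    ext v
    simp [Fin.exists_fin_succ, hN, eq_comm]
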